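/- arXiv:1812.10034 — 3 statements merged into one kernel-verified Lean document; each statement's English description precedes it below -/
import Mathlib

section
/- Let G be a nontrivial connected graph, and let B be a block of G such that rvd(B) is maximum among all blocks of G. Then rvd(G) = rvd(B). -/
open SimpleGraph

/-- A set of vertices is rainbow under a coloring `c` if no two of its vertices
receive the same color. -/
def RainbowSet {V : Type*} (c : V → ℕ) (S : Set V) : Prop := Set.InjOn c S

/-- `c` is a rainbow vertex-disconnection coloring of `G`: for every two distinct
vertices `x, y` there is a set `S` avoiding `x` and `y` such that every `x`-`y` walk
in `G - xy` (which is `G` itself when `x, y` are nonadjacent) meets `S` (i.e. `S` is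
an `x`-`y` vertex-cut), and moreover `S` is rainbow when `x, y` are nonadjacent,
while `S ∪ {x}` or `S ∪ {y}` is rainbow when `x, y` are adjacent. -/
def IsRVDColoring {V : Type*} (G : SimpleGraph V) (c : V → ℕ) : Prop :=
  ∀ x y : V, x ≠ y → ∃ S : Set V, x ∉ S ∧ y ∉ S ∧
    (∀ p : (G.deleteEdges {s(x, y)}).Walk x y, ∃ v ∈ p.support, v ∈ S) ∧
    (¬ G.Adj x y → RainbowSet c S) ∧
    (G.Adj x y → (RainbowSet c (insert x S) ∨ RainbowSet c (insert y S)))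

/-- The rainbow vertex-disconnection number `rvd G`: the minimum number of colors
used by a rainbow vertex-disconnection coloring of `G`. -/
noncomputable def rvd {V : Type*} (G : SimpleGraph V) : ℕ :=
  sInf {k | ∃ c : V → ℕ, IsRVDColoring G c ∧ (Set.range c).ncard = k}

/-- `H` has a cut vertex: a vertex `v` whose removal separates two vertices that
were connected in `H`. -/
def HasCutVertex {W : Type*} (H : SimpleGraph W) : Prop :=
  ∃ (v x y : W), x ≠ v ∧ y ≠ v ∧ H.Reachable x y ∧ ∀ p : H.Walk x y, v ∈ p.support

/-- `B` is a block of `G`: a maximal subgraph of `G` that is connected and has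
no cut vertex. -/
def IsBlock {V : Type*} (G : SimpleGraph V) (B : G.Subgraph) : Prop :=
  B.coe.Connected ∧ ¬ HasCutVertex B.coe ∧
    ∀ B' : G.Subgraph, B ≤ B' → B'.coe.Connected → ¬ HasCutVertex B'.coe → B' = B
/-- `c` satisfies the rainbow vertex-disconnection condition on the subgraph of `G` induced by `A`;
each cut `S` comes with a set `R` containing `x` but not `y` that cannot be left while avoiding
`S` and the edge `xy`. -/
def RVDColoringOn {V : Type*} (G : SimpleGraph V) (A : Set V) (c : V → ℕ) : Prop :=
  ∀ x ∈ A, ∀ y ∈ A, x ≠ y → ∃ S R : Set V, S ⊆ A ∧ x ∉ S ∧ y ∉ S ∧ x ∈ R ∧ y ∉ R ∧ R ⊆ A ∧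
    (∀ u ∈ R, ∀ w ∈ A, w ∉ S → G.Adj u w → s(u, w) ≠ s(x, y) → w ∈ R) ∧
    (¬ G.Adj x y → RainbowSet c S) ∧
    (G.Adj x y → (RainbowSet c (insert x S) ∨ RainbowSet c (insert y S)))

theorem RVDColoringOn.comp {V : Type*} {G : SimpleGraph V} {A : Set V} {c : V → ℕ}
    (h : RVDColoringOn G A c) {f : ℕ → ℕ} (hf : Function.Injective f) :
    RVDColoringOn G A (f ∘ c) := by
  intro x hx y hy hxy
  obtain ⟨S, R, hSA, hxS, hyS, hxR, hyR, hRA, hR, h1, h2⟩ := h x hx y hy hxy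
  refine ⟨S, R, hSA, hxS, hyS, hxR, hyR, hRA, hR, fun ha => ?_, fun ha => ?_⟩
  · exact hf.comp_injOn (h1 ha)
  · exact (h2 ha).imp (fun h => hf.comp_injOn h) (fun h => hf.comp_injOn h)

/-- The condition on a part `A₁` of a separation yields the cuts between vertices of `A₁` in
`A₁ ∪ A₂`. -/
theorem RVDColoringOn.exists_cut_union {V : Type*} {G : SimpleGraph V} {A₁ A₂ : Set V}
    {c₁ c : V → ℕ} (h : RVDColoringOn G A₁ c₁) (hc : Set.EqOn c c₁ A₁)
    (hadj : ∀ u ∈ A₁, u ∉ A₂ → ∀ w ∈ A₂, w ∉ A₁ → ¬ G.Adj u w)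
    (hT : (A₁ ∩ A₂).Subsingleton) {x y : V} (hx : x ∈ A₁) (hy : y ∈ A₁) (hxy : x ≠ y) :
    ∃ S R : Set V, S ⊆ A₁ ∪ A₂ ∧ x ∉ S ∧ y ∉ S ∧ x ∈ R ∧ y ∉ R ∧ R ⊆ A₁ ∪ A₂ ∧
      (∀ u ∈ R, ∀ w ∈ A₁ ∪ A₂, w ∉ S → G.Adj u w → s(u, w) ≠ s(x, y) → w ∈ R) ∧
      (¬ G.Adj x y → RainbowSet c S) ∧
      (G.Adj x y → (RainbowSet c (insert x S) ∨ RainbowSet c (insert y S))) := by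
  obtain ⟨S, R, hSA, hxS, hyS, hxR, hyR, hRA, hR, h1, h2⟩ := h x hx y hy hxy
  have key : ∀ {T : Set V}, T ⊆ A₁ → RainbowSet c₁ T → RainbowSet c T := fun hTA hT' =>
    (Set.EqOn.injOn_iff (hc.mono hTA)).2 hT'
  refine ⟨S, R ∪ {u | u ∈ A₂ ∧ u ∉ A₁ ∧ ∃ t ∈ A₁ ∩ A₂, t ∈ R},
    hSA.trans Set.subset_union_left, hxS, hyS, Or.inl hxR, ?_, ?_, ?_,
    fun ha => key hSA (h1 ha), fun ha => ?_⟩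
  · rintro (h | h)
    · exact hyR h
    · exact h.2.1 hy
  · rintro u (h | h)
    · exact Or.inl (hRA h)
    · exact Or.inr h.1
  · rintro u hu w hw hwS huw he
    by_cases hw1 : w ∈ A₁
    · rcases hu with hu | ⟨hu2, hu1, t, ht, htR⟩
      · exact Or.inl (hR u hu w hw1 hwS huw he)
      · have hw2 : w ∈ A₂ := by
          by_contra hw2
          exact hadj w hw1 hw2 u hu2 hu1 huw.symm
        rw [hT ⟨hw1, hw2⟩ ht]
        exact Or.inl htR
    · have hw2 : w ∈ A₂ := hw.resolve_left hw1
      rcases hu with hu | ⟨hu2, hu1, t, ht, htR⟩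
      · have hu2 : u ∈ A₂ := by
          by_contra hu2
          exact hadj u (hRA hu) hu2 w hw2 hw1 huw
        exact Or.inr ⟨hw2, hw1, u, ⟨hRA hu, hu2⟩, hu⟩
      · exact Or.inr ⟨hw2, hw1, t, ht, htR⟩
  · exact (h2 ha).imp (key (Set.insert_subset hx hSA)) (key (Set.insert_subset hy hSA))

theorem exists_cut_of_separated {V : Type*} {G : SimpleGraph V} {A₁ A₂ : Set V} (c : V → ℕ)
    (hadj : ∀ u ∈ A₁, u ∉ A₂ → ∀ w ∈ A₂, w ∉ A₁ → ¬ G.Adj u w)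
    (hT : (A₁ ∩ A₂).Subsingleton) {x y : V} (hx : x ∈ A₁) (hx2 : x ∉ A₂) (hy : y ∈ A₂)
    (hy1 : y ∉ A₁) :
    ∃ S R : Set V, S ⊆ A₁ ∪ A₂ ∧ x ∉ S ∧ y ∉ S ∧ x ∈ R ∧ y ∉ R ∧ R ⊆ A₁ ∪ A₂ ∧
      (∀ u ∈ R, ∀ w ∈ A₁ ∪ A₂, w ∉ S → G.Adj u w → s(u, w) ≠ s(x, y) → w ∈ R) ∧
      (¬ G.Adj x y → RainbowSet c S) ∧
      (G.Adj x y → (RainbowSet c (insert x S) ∨ RainbowSet c (insert y S))) := by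
  refine ⟨A₁ ∩ A₂, A₁ \ A₂, fun u hu => Or.inl hu.1, fun h => hx2 h.2, fun h => hy1 h.1,
    ⟨hx, hx2⟩, fun h => hy1 h.1, fun u hu => Or.inl hu.1, ?_, fun _ => hT.injOn c,
    fun ha => absurd ha (hadj x hx hx2 y hy hy1)⟩
  rintro u ⟨hu1, hu2⟩ w hw hwT huw -
  by_cases hw2 : w ∈ A₂
  · exact absurd huw (hadj u hu1 hu2 w hw2 fun hw1 => hwT ⟨hw1, hw2⟩)
  · exact ⟨hw.resolve_right hw2, hw2⟩

/-- Colorings of the two parts of a separation of order at most one that agree on the common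
vertex can be glued. -/
theorem RVDColoringOn.union {V : Type*} {G : SimpleGraph V} {A₁ A₂ : Set V} {c₁ c₂ c : V → ℕ}
    (h₁ : RVDColoringOn G A₁ c₁) (h₂ : RVDColoringOn G A₂ c₂)
    (hc₁ : Set.EqOn c c₁ A₁) (hc₂ : Set.EqOn c c₂ A₂)
    (hadj : ∀ u ∈ A₁, u ∉ A₂ → ∀ w ∈ A₂, w ∉ A₁ → ¬ G.Adj u w)
    (hT : (A₁ ∩ A₂).Subsingleton) : RVDColoringOn G (A₁ ∪ A₂) c := by
  have hadj' : ∀ u ∈ A₂, u ∉ A₁ → ∀ w ∈ A₁, w ∉ A₂ → ¬ G.Adj u w :=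
    fun u hu hu1 w hw hw2 huw => hadj w hw hw2 u hu hu1 huw.symm
  have hT' : (A₂ ∩ A₁).Subsingleton := by rwa [Set.inter_comm]
  intro x hx y hy hxy
  by_cases hx1 : x ∈ A₁
  · by_cases hy1 : y ∈ A₁
    · exact h₁.exists_cut_union hc₁ hadj hT hx1 hy1 hxy
    have hy2 := hy.resolve_left hy1
    by_cases hx2 : x ∈ A₂
    · rw [Set.union_comm]
      exact h₂.exists_cut_union hc₂ hadj' hT' hx2 hy2 hxy
    · exact exists_cut_of_separated c hadj hT hx1 hx2 hy2 hy1
  · have hx2 := hx.resolve_left hx1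
    rw [Set.union_comm]
    by_cases hy2 : y ∈ A₂
    · exact h₂.exists_cut_union hc₂ hadj' hT' hx2 hy2 hxy
    · exact exists_cut_of_separated c hadj' hT' hx2 hx1 (hy.resolve_right hy2) hy2

/-- A graph that is disconnected or has a cut vertex has a proper separation of order at most
one. -/
theorem exists_separation {W : Type*} [Nonempty W] (H : SimpleGraph W)
    (h : ¬ (H.Connected ∧ ¬ HasCutVertex H)) :
    ∃ C₁ C₂ : Set W, C₁ ∪ C₂ = Set.univ ∧ C₁ ≠ Set.univ ∧ C₂ ≠ Set.univ ∧
      (C₁ ∩ C₂).Subsingleton ∧ ∀ u ∈ C₁, u ∉ C₂ → ∀ w ∈ C₂, w ∉ C₁ → ¬ H.Adj u w := by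
  by_cases hc : H.Connected
  · obtain ⟨v, x, y, hxv, hyv, -, hv⟩ : HasCutVertex H := by
      by_contra hcut
      exact h ⟨hc, hcut⟩
    let C : Set W := {u | ∃ p : H.Walk x u, v ∉ p.support}
    have hvC : v ∉ C := fun ⟨p, hp⟩ => hp p.end_mem_support
    have hxC : x ∈ C := ⟨Walk.nil, by simpa using hxv.symm⟩
    have hyC : y ∉ C := fun ⟨p, hp⟩ => hp (hv p)
    refine ⟨insert v C, Cᶜ, ?_, ?_, ?_, ?_, ?_⟩
    · rw [Set.insert_union, Set.union_compl_self]
      exact Set.insert_eq_of_mem trivial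
    · intro h
      have : y ∈ insert v C := h ▸ Set.mem_univ y
      exact this.elim hyv hyC
    · intro h
      have : x ∈ Cᶜ := h ▸ Set.mem_univ x
      exact this hxC
    · refine Set.subsingleton_singleton (a := v) |>.anti ?_
      rintro u ⟨hu | hu, hu'⟩
      · exact hu
      · exact absurd hu hu'
    · rintro u - hu w - hw huw
      obtain ⟨p, hp⟩ : u ∈ C := not_not.1 hu
      refine hw (Or.inr ⟨p.concat huw, ?_⟩)
      rw [Walk.support_concat, List.mem_append, List.mem_singleton]
      rintro (h | h)
      · exact hp h
      · exact hw (Or.inl h.symm)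
  · obtain ⟨x, y, hxy⟩ : ∃ x y, ¬ H.Reachable x y := by
      by_contra! hr
      exact hc ⟨hr⟩
    refine ⟨{u | H.Reachable x u}, {u | H.Reachable x u}ᶜ, Set.union_compl_self _, ?_, ?_, ?_, ?_⟩
    · intro h
      exact hxy (h ▸ Set.mem_univ y : y ∈ {u | H.Reachable x u})
    · intro h
      exact (h ▸ Set.mem_univ x : x ∈ {u | H.Reachable x u}ᶜ) (Reachable.refl x)
    · rw [Set.inter_compl_self]
      exact Set.subsingleton_empty
    · intro u hu _ w hw _ huw
      exact hw (hu.trans huw.reachable)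

/-- If every connected induced subgraph without cut vertices has a coloring with colors below `k`,
then so does every induced subgraph. -/
theorem exists_rvdColoringOn {V : Type*} [Finite V] (G : SimpleGraph V) (k : ℕ)
    (h : ∀ A : Set V, ((⊤ : G.Subgraph).induce A).coe.Connected →
      ¬ HasCutVertex ((⊤ : G.Subgraph).induce A).coe →
      ∃ c : V → ℕ, (∀ x ∈ A, c x < k) ∧ RVDColoringOn G A c) (A : Set V) :
    ∃ c : V → ℕ, (∀ x ∈ A, c x < k) ∧ RVDColoringOn G A c := by
  classical
  induction A using WellFoundedLT.induction with
  | ind A ih =>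
  rcases A.eq_empty_or_nonempty with rfl | hA
  · exact ⟨fun _ => 0, by simp, fun x hx => hx.elim⟩
  by_cases hcon : ((⊤ : G.Subgraph).induce A).coe.Connected ∧
      ¬ HasCutVertex ((⊤ : G.Subgraph).induce A).coe
  · exact h A hcon.1 hcon.2
  have : Nonempty ((⊤ : G.Subgraph).induce A).verts := hA.to_subtype
  obtain ⟨C₁, C₂, hU, hC₁, hC₂, hT, hadj⟩ := exists_separation _ hcon
  have lt : ∀ {C : Set ((⊤ : G.Subgraph).induce A).verts}, C ≠ Set.univ →
      (Subtype.val '' C) < A := by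
    intro C hC
    refine lt_of_le_of_ne (Subtype.coe_image_subset A C) fun he => hC ?_
    refine Set.eq_univ_of_forall fun u => ?_
    have hu : u.1 ∈ Subtype.val '' C := he.symm ▸ u.2
    exact (Subtype.val_injective.mem_set_image).1 hu
  obtain ⟨c₁, hk₁, h₁⟩ := ih _ (lt hC₁)
  obtain ⟨c₂, hk₂, h₂⟩ := ih _ (lt hC₂)
  have hAU : A = Subtype.val '' C₁ ∪ Subtype.val '' C₂ := by
    rw [← Set.image_union, hU]
    exact Subtype.coe_image_univ A |>.symm
  set A₁ : Set V := Subtype.val '' C₁ with hA₁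
  set A₂ : Set V := Subtype.val '' C₂ with hA₂
  have hT' : (A₁ ∩ A₂).Subsingleton := by
    rw [hA₁, hA₂, ← Set.image_inter Subtype.val_injective]
    exact hT.image _
  have hadj' : ∀ u ∈ A₁, u ∉ A₂ → ∀ w ∈ A₂, w ∉ A₁ → ¬ G.Adj u w := by
    rintro _ ⟨u, hu, rfl⟩ hu2 _ ⟨w, hw, rfl⟩ hw1 huw
    refine hadj u hu (fun h => hu2 ⟨u, h, rfl⟩) w hw (fun h => hw1 ⟨w, h, rfl⟩) ?_
    exact ⟨u.2, w.2, huw⟩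
  obtain ⟨d, hdk, hd, hdc⟩ : ∃ d : V → ℕ, (∀ x ∈ A₂, d x < k) ∧ RVDColoringOn G A₂ d ∧
      ∀ x ∈ A₁ ∩ A₂, c₁ x = d x := by
    rcases (A₁ ∩ A₂).eq_empty_or_nonempty with he | ⟨t, ht⟩
    · exact ⟨c₂, hk₂, h₂, fun x hx => by simp [he] at hx⟩
    · refine ⟨Equiv.swap (c₁ t) (c₂ t) ∘ c₂, fun x hx => ?_, h₂.comp (Equiv.injective _), ?_⟩
      · have := hk₁ t ht.1
        have := hk₂ t ht.2
        have := hk₂ x hx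
        simp only [Function.comp_apply, Equiv.swap_apply_def]
        split_ifs <;> assumption
      · intro x hx
        rw [hT' hx ht]
        simp
  have e₁ : Set.EqOn (A₁.piecewise c₁ d) c₁ A₁ := A₁.piecewise_eqOn c₁ d
  have e₂ : Set.EqOn (A₁.piecewise c₁ d) d A₂ := by
    intro x hx
    by_cases hx1 : x ∈ A₁
    · rw [Set.piecewise_eq_of_mem _ _ _ hx1]
      exact hdc x ⟨hx1, hx⟩
    · exact Set.piecewise_eq_of_notMem _ _ _ hx1
  refine ⟨A₁.piecewise c₁ d, fun x hx => ?_, ?_⟩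
  · rw [hAU] at hx
    rcases hx with hx | hx
    · rw [e₁ hx]
      exact hk₁ x hx
    · rw [e₂ hx]
      exact hdk x hx
  · rw [hAU]
    exact h₁.union hd e₁ e₂ hadj' hT'

theorem RVDColoringOn.isRVDColoring {V : Type*} {G : SimpleGraph V} {c : V → ℕ}
    (h : RVDColoringOn G Set.univ c) : IsRVDColoring G c := by
  intro x y hxy
  obtain ⟨S, R, -, hxS, hyS, hxR, hyR, -, hR, h1, h2⟩ := h x trivial y trivial hxy
  refine ⟨S, hxS, hyS, fun p => ?_, h1, h2⟩
  by_contra! hp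
  have key : ∀ {u w : V} (q : (G.deleteEdges {s(x, y)}).Walk u w),
      (∀ v ∈ q.support, v ∉ S) → u ∈ R → w ∈ R := by
    intro u w q
    induction q with
    | nil => exact fun _ h => h
    | cons ha q ih =>
      intro hq hu
      rw [deleteEdges_adj] at ha
      exact ih (fun v hv => hq v (by simp [hv]))
        (hR _ hu _ trivial (hq _ (by simp)) ha.1 ha.2)
  exact hyR (key p hp hxR)

/-- A coloring of a subgraph restricts to every vertex set whose induced subgraph it contains. -/
theorem IsRVDColoring.rvdColoringOn {V : Type*} {G : SimpleGraph V} {B : G.Subgraph} {A : Set V}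
    (hAB : (⊤ : G.Subgraph).induce A ≤ B) {c : V → ℕ}
    (h : IsRVDColoring B.coe (c ∘ Subtype.val)) : RVDColoringOn G A c := by
  have hA : A ⊆ B.verts := hAB.1
  have hadj : ∀ {u w}, u ∈ A → w ∈ A → G.Adj u w → B.Adj u w :=
    fun hu hw huw => hAB.2 ⟨hu, hw, huw⟩
  intro x hx y hy hxy
  obtain ⟨S, hxS, hyS, hp, h1, h2⟩ := h ⟨x, hA hx⟩ ⟨y, hA hy⟩ (by simpa using hxy)
  refine ⟨A ∩ Subtype.val '' S, {u | u ∈ A ∧ ∃ hu : u ∈ B.verts,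
      ∃ p : (B.coe.deleteEdges {s(⟨x, hA hx⟩, ⟨y, hA hy⟩)}).Walk ⟨x, hA hx⟩ ⟨u, hu⟩,
        ∀ v ∈ p.support, v ∉ S}, Set.inter_subset_left, ?_, ?_, ?_, ?_, fun u hu => hu.1, ?_,
      ?_, ?_⟩
  · rintro ⟨-, u, hu, rfl⟩
    exact hxS hu
  · rintro ⟨-, u, hu, rfl⟩
    exact hyS hu
  · exact ⟨hx, hA hx, Walk.nil, by simpa using hxS⟩
  · rintro ⟨-, _, p, hpS⟩
    obtain ⟨v, hv, hvS⟩ := hp p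
    exact hpS v hv hvS
  · rintro u ⟨huA, hu, p, hpS⟩ w hw hwS huw he
    refine ⟨hw, hA hw, Walk.concat (v := (⟨u, hu⟩ : B.verts)) (w := (⟨w, hA hw⟩ : B.verts)) p ?_, ?_⟩
    · rw [deleteEdges_adj]
      refine ⟨hadj huA hw huw, fun hm => he ?_⟩
      exact congrArg (Sym2.map Subtype.val) hm
    · intro v hv
      rw [Walk.support_concat, List.mem_append, List.mem_singleton] at hv
      rcases hv with hv | rfl
      · exact hpS v hv
      · exact fun hvS => hwS ⟨hw, _, hvS, rfl⟩
  · intro ha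
    refine Set.InjOn.mono Set.inter_subset_right (Set.InjOn.image_of_comp (h1 ?_))
    exact fun hb => ha hb.adj_sub
  · intro ha
    have lift : ∀ z : B.verts, RainbowSet (c ∘ Subtype.val) (insert z S) →
        RainbowSet c (insert z.1 (A ∩ Subtype.val '' S)) := by
      intro z hz
      have := Set.InjOn.image_of_comp hz
      rw [Set.image_insert_eq] at this
      exact this.mono (Set.insert_subset_insert Set.inter_subset_right)
    exact (h2 (hadj hx hy ha)).imp (lift _) (lift _)

theorem IsRVDColoring.restrict {V : Type*} {G : SimpleGraph V} {c : V → ℕ}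
    (h : IsRVDColoring G c) (B : G.Subgraph) : IsRVDColoring B.coe (c ∘ Subtype.val) := by
  intro x y hxy
  obtain ⟨S, hxS, hyS, hp, h1, h2⟩ := h x y (Subtype.coe_injective.ne hxy)
  have lift : ∀ {T : Set V} {U : Set B.verts}, Set.MapsTo Subtype.val U T → RainbowSet c T →
      RainbowSet (c ∘ Subtype.val) U :=
    fun hU hT => hT.comp Subtype.val_injective.injOn hU
  refine ⟨Subtype.val ⁻¹' S, hxS, hyS, fun p => ?_, fun _ => ?_, fun ha => ?_⟩
  · let f : B.coe.deleteEdges {s(x, y)} →g G.deleteEdges {s(x.1, y.1)} :=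
      { toFun := Subtype.val
        map_rel' := by
          intro u w huw
          rw [deleteEdges_adj] at huw ⊢
          refine ⟨huw.1.adj_sub, fun hm => huw.2 ?_⟩
          exact Sym2.map.injective Subtype.val_injective hm }
    obtain ⟨v, hv, hvS⟩ := hp (p.map f)
    rw [Walk.support_map, List.mem_map] at hv
    obtain ⟨u, hu, rfl⟩ := hv
    exact ⟨u, hu, hvS⟩
  · by_cases hG : G.Adj x y
    · rcases h2 hG with h | h
      · exact lift (fun u hu => Or.inr hu) h
      · exact lift (fun u hu => Or.inr hu) h
    · exact lift (fun u hu => hu) (h1 hG)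
  · refine (h2 ha.adj_sub).imp (lift ?_) (lift ?_) <;>
    · rintro u (rfl | hu)
      · exact Or.inl rfl
      · exact Or.inr hu

theorem isRVDColoring_of_injective {V : Type*} (G : SimpleGraph V) {c : V → ℕ}
    (hc : Function.Injective c) : IsRVDColoring G c := by
  intro x y hxy
  refine ⟨{x, y}ᶜ, by simp, by simp, fun p => ?_, fun _ => hc.injOn, fun _ => Or.inl hc.injOn⟩
  cases p with
  | nil => exact absurd rfl hxy
  | @cons _ w _ ha q =>
    refine ⟨w, by simp, ?_⟩
    rw [deleteEdges_adj] at ha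
    rintro (rfl | rfl)
    · exact ha.1.ne rfl
    · exact ha.2 rfl

theorem exists_isRVDColoring_ncard_eq_rvd {V : Type*} [Finite V] (G : SimpleGraph V) :
    ∃ c : V → ℕ, IsRVDColoring G c ∧ (Set.range c).ncard = rvd G := by
  obtain ⟨f, hf⟩ := Countable.exists_injective_nat V
  exact Nat.sInf_mem (s := {k | ∃ c : V → ℕ, IsRVDColoring G c ∧ (Set.range c).ncard = k})
    ⟨_, f, isRVDColoring_of_injective G hf, rfl⟩

theorem rvd_le {V : Type*} {G : SimpleGraph V} {c : V → ℕ} (h : IsRVDColoring G c) :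
    rvd G ≤ (Set.range c).ncard :=
  Nat.sInf_le ⟨c, h, rfl⟩

theorem rvd_coe_le {V : Type*} [Finite V] {G : SimpleGraph V} (B : G.Subgraph) :
    rvd B.coe ≤ rvd G := by
  obtain ⟨c, hc, hk⟩ := exists_isRVDColoring_ncard_eq_rvd G
  rw [← hk]
  exact (rvd_le (hc.restrict B)).trans
    (Set.ncard_le_ncard (Set.range_comp_subset_range _ _) (Set.finite_range c))

theorem exists_isBlock_ge {V : Type*} [Finite V] {G : SimpleGraph V} (H : G.Subgraph)
    (hc : H.coe.Connected) (hcut : ¬ HasCutVertex H.coe) : ∃ B, H ≤ B ∧ IsBlock G B := by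
  obtain ⟨B, hHB, hB⟩ := (Set.toFinite
    {B : G.Subgraph | B.coe.Connected ∧ ¬ HasCutVertex B.coe}).exists_le_maximal ⟨hc, hcut⟩
  exact ⟨B, hHB, hB.prop.1, hB.prop.2, fun B' hBB' h1 h2 => (hB.eq_of_le ⟨h1, h2⟩ hBB').symm⟩

/-- An optimal coloring may be taken to use the colors below `k` for any `k ≥ rvd B`, and to be
defined on the whole vertex set. -/
theorem exists_isRVDColoring_lt {V : Type*} [Finite V] {G : SimpleGraph V} (B : G.Subgraph)
    {k : ℕ} (hk : rvd B.coe ≤ k) :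
    ∃ c : V → ℕ, (∀ x ∈ B.verts, c x < k) ∧ IsRVDColoring B.coe (c ∘ Subtype.val) := by
  classical
  obtain ⟨c, hc, hcard⟩ := exists_isRVDColoring_ncard_eq_rvd B.coe
  have e := Finite.equivFin (Set.range c)
  have hle : Nat.card (Set.range c) ≤ k := by
    rw [Nat.card_coe_set_eq, hcard]
    exact hk
  let d : B.verts → ℕ := fun x => e ⟨c x, x, rfl⟩
  have hd : ∀ u w, d u = d w → c u = c w := fun u w huw =>
    congrArg Subtype.val (e.injective (Fin.ext huw))
  refine ⟨fun x => if hx : x ∈ B.verts then d ⟨x, hx⟩ else 0, fun x hx => ?_, ?_⟩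
  · simp only [hx, dite_true]
    exact (e _).2.trans_le hle
  · have hcd : (fun x => if hx : x ∈ B.verts then d ⟨x, hx⟩ else 0) ∘ Subtype.val = d := by
      funext x
      simp
    rw [hcd]
    have lift : ∀ {T : Set B.verts}, RainbowSet c T → RainbowSet d T :=
      fun hT u hu w hw huw => hT hu hw (hd u w huw)
    intro x y hxy
    obtain ⟨S, hxS, hyS, hp, h1, h2⟩ := hc x y hxy
    exact ⟨S, hxS, hyS, hp, fun ha => lift (h1 ha), fun ha => (h2 ha).imp lift lift⟩

/-- Let `G` be a nontrivial connected graph and `B` a block of `G` whose `rvd` is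
maximum among all blocks of `G`. Then `rvd G = rvd B`. -/
theorem stmt1 {V : Type*} [Fintype V] (G : SimpleGraph V) (hG : G.Connected)
    (hn : 2 ≤ Fintype.card V) (B : G.Subgraph) (hB : IsBlock G B)
    (hmax : ∀ B' : G.Subgraph, IsBlock G B' → rvd B'.coe ≤ rvd B.coe) :
    rvd G = rvd B.coe := by
  refine le_antisymm ?_ (rvd_coe_le B)
  obtain ⟨c, hck, hc⟩ := exists_rvdColoringOn G (rvd B.coe) (fun A hA hcut => by
    obtain ⟨B', hAB, hB'⟩ := exists_isBlock_ge _ hA hcut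
    obtain ⟨c, hck, hc⟩ := exists_isRVDColoring_lt B' (hmax B' hB')
    exact ⟨c, fun x hx => hck x (hAB.1 hx), hc.rvdColoringOn hAB⟩) Set.univ
  calc rvd G ≤ (Set.range c).ncard := rvd_le hc.isRVDColoring
    _ ≤ (Set.Iio (rvd B.coe)).ncard :=
      Set.ncard_le_ncard (by rintro _ ⟨x, rfl⟩; exact hck x trivial) (Set.finite_Iio _)
    _ = rvd B.coe := by
      rw [← Finset.coe_Iio, Set.ncard_coe_finset, Nat.card_Iio]
end

section
/- Let G be a nontrivial connected graph of order n. If there is exactly one unordered pair of distinct vertices of G which do not have at least two common neighbors, then rvd(G) = n − 1. -/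
open SimpleGraph

/-- `u` and `v` have at least two common neighbors in `G`. -/
def TwoCommonNbrs {V : Type*} (G : SimpleGraph V) (u v : V) : Prop :=
  ∃ w₁ w₂ : V, w₁ ≠ w₂ ∧ G.Adj u w₁ ∧ G.Adj v w₁ ∧ G.Adj u w₂ ∧ G.Adj v w₂

/-- A walk between two distinct vertices meets the neighborhood of its start. -/
theorem exists_mem_support_neighborSet {V : Type*} {H : SimpleGraph V} {x y : V} (hxy : x ≠ y)
    (p : H.Walk x y) : ∃ w ∈ p.support, w ∈ H.neighborSet x := by
  cases p with
  | nil => exact absurd rfl hxy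
  | cons h q => exact ⟨_, by simp, h⟩

/-- Under a rainbow vertex-disconnection coloring, two distinct vertices with at least two
common neighbors receive different colors. -/
theorem IsRVDColoring.ne_of_twoCommonNbrs {V : Type*} {G : SimpleGraph V} {c : V → ℕ}
    (hc : IsRVDColoring G c) {a b : V} (hab : a ≠ b) (h : TwoCommonNbrs G a b) : c a ≠ c b := by
  obtain ⟨x, y, hxy, hax, hbx, hay, hby⟩ := h
  obtain ⟨S, hxS, hyS, hcut, hnadj, hadj⟩ := hc x y hxy
  have hmem : ∀ w, G.Adj w x → G.Adj w y → w ∈ S := by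
    intro w hwx hwy
    have h₁ : (G.deleteEdges {s(x, y)}).Adj x w := by
      simp [SimpleGraph.deleteEdges_adj, hwx.symm, hwy.ne, hxy]
    have h₂ : (G.deleteEdges {s(x, y)}).Adj w y := by
      simp [SimpleGraph.deleteEdges_adj, hwy, hwx.ne, hxy.symm]
    obtain ⟨z, hz, hzS⟩ := hcut (.cons h₁ (.cons h₂ .nil))
    have hz' : z = x ∨ z = w ∨ z = y := by simpa using hz
    rcases hz' with rfl | rfl | rfl
    · exact absurd hzS hxS
    · exact hzS
    · exact absurd hzS hyS
  have hS : RainbowSet c S := by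
    by_cases hG : G.Adj x y
    · exact (hadj hG).elim (·.mono (Set.subset_insert _ _)) (·.mono (Set.subset_insert _ _))
    · exact hnadj hG
  exact fun hcab => hab (hS (hmem a hax hay) (hmem b hbx hby) hcab)

/-- A coloring whose only possible repetition is on a pair of vertices without two common
neighbors is a rainbow vertex-disconnection coloring. -/
theorem isRVDColoring_of_not_twoCommonNbrs {V : Type*} {G : SimpleGraph V} {u v : V}
    (huv : ¬ TwoCommonNbrs G u v) {c : V → ℕ}
    (hc : ∀ S : Set V, u ∉ S ∨ v ∉ S → RainbowSet c S) : IsRVDColoring G c := by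
  intro x y hxy
  set H := G.deleteEdges {s(x, y)} with hH
  have hHG : ∀ {a b}, H.Adj a b → G.Adj a b := fun h => (G.deleteEdges_adj.1 h).1
  have hnot : ¬ H.Adj x y := by simp [hH, SimpleGraph.deleteEdges_adj]
  suffices hS : ∃ S : Set V, (S = H.neighborSet x ∨ S = H.neighborSet y) ∧
      (RainbowSet c (insert x S) ∨ RainbowSet c (insert y S)) by
    obtain ⟨S, hS, hr⟩ := hS
    refine ⟨S, ?_, ?_, fun p => ?_, fun _ => ?_, fun _ => hr⟩
    · rcases hS with rfl | rfl <;> simp [H.adj_comm y x, hnot]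
    · rcases hS with rfl | rfl <;> simp [hnot]
    · rcases hS with rfl | rfl
      · exact exists_mem_support_neighborSet hxy p
      · simpa using exists_mem_support_neighborSet hxy.symm p.reverse
    · exact hr.elim (·.mono (Set.subset_insert _ _)) (·.mono (Set.subset_insert _ _))
  by_cases hx : x = u ∨ x = v
  · refine ⟨_, .inl rfl, .inr (hc _ ?_)⟩
    rcases hx with rfl | rfl <;> simp [hxy]
  by_cases hy : y = u ∨ y = v
  · refine ⟨_, .inl rfl, .inl (hc _ ?_)⟩
    rcases hy with rfl | rfl <;> simp [hxy.symm, hnot]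
  push Not at hx hy
  by_cases hux : G.Adj u x ∧ G.Adj v x
  · have huy : ¬ (G.Adj u y ∧ G.Adj v y) := fun h =>
      huv ⟨x, y, hxy, hux.1, hux.2, h.1, h.2⟩
    refine ⟨_, .inr rfl, .inr (hc _ ?_)⟩
    rcases not_and_or.1 huy with h | h
    · exact .inl fun hm => hm.elim hy.1.symm fun hm => h (hHG hm).symm
    · exact .inr fun hm => hm.elim hy.2.symm fun hm => h (hHG hm).symm
  · refine ⟨_, .inl rfl, .inl (hc _ ?_)⟩
    rcases not_and_or.1 hux with h | h
    · exact .inl fun hm => hm.elim hx.1.symm fun hm => h (hHG hm).symm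
    · exact .inr fun hm => hm.elim hx.2.symm fun hm => h (hHG hm).symm

/-- Two distinct vertices of a finite type can be identified by a coloring with one color fewer
than there are vertices. -/
theorem exists_coloring_identifying {V : Type*} [Fintype V] {u v : V} (huv : u ≠ v) :
    ∃ c : V → ℕ, (∀ S : Set V, u ∉ S ∨ v ∉ S → Set.InjOn c S) ∧
      (Set.range c).ncard = Fintype.card V - 1 := by
  classical
  let e : V → ℕ := fun w => Fintype.equivFin V w
  have he : Function.Injective e := Fin.val_injective.comp (Fintype.equivFin V).injective
  have hinj : ∀ S : Set V, u ∉ S ∨ v ∉ S → Set.InjOn (fun w => e (if w = v then u else w)) S := by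
    intro S hS a ha b hb hab
    have hab' := he hab
    grind
  refine ⟨fun w => e (if w = v then u else w), hinj, ?_⟩
  have hrange : Set.range (fun w => e (if w = v then u else w)) =
      (fun w => e (if w = v then u else w)) '' {v}ᶜ := by
    refine Set.Subset.antisymm ?_ (Set.image_subset_range _ _)
    rintro _ ⟨w, rfl⟩
    by_cases hw : w = v
    · exact ⟨u, huv, by simp [hw]⟩
    · exact ⟨w, hw, rfl⟩
  rw [hrange, (hinj _ (.inr (by simp))).ncard_image, Set.ncard_compl, Set.ncard_singleton,
    Nat.card_eq_fintype_card]

/-- If a nontrivial connected graph `G` of order `n` has exactly one unordered pair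
of distinct vertices without at least two common neighbors, then `rvd G = n - 1`. -/
theorem stmt9 {V : Type*} [Fintype V] (G : SimpleGraph V) (hG : G.Connected)
    (hn : 2 ≤ Fintype.card V)
    (h : ∃ u v : V, u ≠ v ∧ ¬ TwoCommonNbrs G u v ∧
      ∀ x y : V, x ≠ y → ¬ TwoCommonNbrs G x y → (x = u ∧ y = v) ∨ (x = v ∧ y = u)) :
    rvd G = Fintype.card V - 1 := by
  obtain ⟨u, v, huv, hnot, huniq⟩ := h
  obtain ⟨c, hc, hcard⟩ := exists_coloring_identifying huv
  have hmem : Fintype.card V - 1 ∈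
      {k | ∃ c : V → ℕ, IsRVDColoring G c ∧ (Set.range c).ncard = k} :=
    ⟨c, isRVDColoring_of_not_twoCommonNbrs hnot hc, hcard⟩
  refine le_antisymm (Nat.sInf_le hmem) (le_csInf ⟨_, hmem⟩ ?_)
  rintro _ ⟨d, hd, rfl⟩
  have hinj : Set.InjOn d {v}ᶜ := by
    intro a ha b hb hab
    by_contra hne
    refine hd.ne_of_twoCommonNbrs hne ?_ hab
    by_contra htwo
    rcases huniq a b hne htwo with h | h
    · exact hb h.2
    · exact ha h.1
  calc Fintype.card V - 1 = (d '' {v}ᶜ).ncard := by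
        rw [hinj.ncard_image, Set.ncard_compl, Set.ncard_singleton, Nat.card_eq_fintype_card]
    _ ≤ (Set.range d).ncard :=
        Set.ncard_le_ncard (Set.image_subset_range _ _) (Set.finite_range d)
end

section
/- Let W_n = C_n ∨ K_1 be the wheel of order n + 1 ≥ 5 (so n ≥ 4). Then rvd(W_n) = 3 if 4 divides n, and rvd(W_n) = 4 if 4 does not divide n. -/
open SimpleGraph

/-- The wheel `W n = C n ∨ K 1`: the join of the cycle on `n` vertices with a hub
vertex (`none`) adjacent to all vertices of the cycle. -/
def wheelGraph (n : ℕ) : SimpleGraph (Option (Fin n)) :=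
  SimpleGraph.fromRel (fun x y => x = none ∨
    ∃ i j : Fin n, x = some i ∧ y = some j ∧ (SimpleGraph.cycleGraph n).Adj i j)

/-- A coloring is a rainbow vertex-disconnection coloring as soon as, among any two distinct
vertices, one has a rainbow neighborhood. -/
theorem isRVDColoring_of_injOn_neighborSet {V : Type*} {G : SimpleGraph V} {c : V → ℕ}
    (h : ∀ x y : V, x ≠ y → Set.InjOn c (G.neighborSet x) ∨ Set.InjOn c (G.neighborSet y)) :
    IsRVDColoring G c := by
  intro x y hxy
  rcases h x y hxy with hx | hy
  · refine ⟨G.neighborSet x \ {y}, by simp, by simp, fun p => ?_, fun _ => ?_, fun ha => .inr ?_⟩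
    · cases p with
      | nil => exact absurd rfl hxy
      | @cons _ v _ hv q =>
        rw [SimpleGraph.deleteEdges_adj] at hv
        refine ⟨v, by simp, hv.1, ?_⟩
        rintro rfl
        exact hv.2 rfl
    · exact hx.mono Set.sdiff_subset
    · exact hx.mono (Set.insert_subset ha Set.sdiff_subset)
  · refine ⟨G.neighborSet y \ {x}, by simp, by simp, fun p => ?_, fun _ => ?_, fun ha => .inl ?_⟩
    · obtain ⟨q, rfl⟩ : ∃ q, p = SimpleGraph.Walk.reverse q := ⟨p.reverse, by simp⟩
      cases q with
      | nil => exact absurd rfl hxy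
      | @cons _ v _ hv q =>
        rw [SimpleGraph.deleteEdges_adj] at hv
        refine ⟨v, by simp, hv.1, ?_⟩
        rintro rfl
        exact hv.2 Sym2.eq_swap
    · exact hy.mono Set.sdiff_subset
    · exact hy.mono (Set.insert_subset ha.symm Set.sdiff_subset)

/-- An `x`-`y` vertex-cut contains every common neighbor of `x` and `y`. -/
theorem mem_cut_of_adj_of_adj {V : Type*} {G : SimpleGraph V} {x y v : V} {S : Set V}
    (hx : x ∉ S) (hy : y ∉ S)
    (hS : ∀ p : (G.deleteEdges {s(x, y)}).Walk x y, ∃ v ∈ p.support, v ∈ S)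
    (hxv : G.Adj x v) (hvy : G.Adj v y) : v ∈ S := by
  have h₁ : (G.deleteEdges {s(x, y)}).Adj x v := by
    rw [SimpleGraph.deleteEdges_adj]
    refine ⟨hxv, ?_⟩
    simp [hvy.ne, hxv.ne']
  have h₂ : (G.deleteEdges {s(x, y)}).Adj v y := by
    rw [SimpleGraph.deleteEdges_adj]
    refine ⟨hvy, ?_⟩
    simp [hvy.ne, hxv.ne']
  obtain ⟨w, hw, hwS⟩ := hS (.cons h₁ (.cons h₂ .nil))
  simp only [SimpleGraph.Walk.support_cons, SimpleGraph.Walk.support_nil, List.mem_cons,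
    List.not_mem_nil, or_false] at hw
  rcases hw with rfl | rfl | rfl
  · exact absurd hwS hx
  · exact hwS
  · exact absurd hwS hy

theorem cycleGraph_adj_iff_val {n : ℕ} (hn : 2 ≤ n) (i j : Fin n) :
    (cycleGraph n).Adj i j ↔ (i.val + 1) % n = j.val ∨ (j.val + 1) % n = i.val := by
  have key : ∀ a b : Fin n, (a - b).val = 1 ↔ (b.val + 1) % n = a.val := by
    intro a b
    have ha := a.isLt
    have hb := b.isLt
    rw [Fin.val_sub]
    rcases Nat.lt_or_ge a.val b.val with h | h
    · rw [Nat.mod_eq_of_lt (by omega)]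
      rcases Nat.lt_or_ge (b.val + 1) n with h' | h'
      · rw [Nat.mod_eq_of_lt h']; omega
      · rw [show b.val + 1 = n by omega, Nat.mod_self]; omega
    · rw [show n - b.val + a.val = (a.val - b.val) + n by omega, Nat.add_mod_right,
        Nat.mod_eq_of_lt (by omega)]
      rcases Nat.lt_or_ge (b.val + 1) n with h' | h'
      · rw [Nat.mod_eq_of_lt h']; omega
      · rw [show b.val + 1 = n by omega, Nat.mod_self]; omega
  rw [cycleGraph_adj', key, key, or_comm]

theorem wheelGraph_adj_none_some {n : ℕ} (i : Fin n) : (wheelGraph n).Adj none (some i) := by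
  simp [wheelGraph]

theorem wheelGraph_adj_some_some {n : ℕ} (i j : Fin n) :
    (wheelGraph n).Adj (some i) (some j) ↔ (cycleGraph n).Adj i j := by
  simp only [wheelGraph, SimpleGraph.fromRel_adj]
  constructor
  · rintro ⟨-, (h | ⟨a, b, ha, hb, h⟩) | (h | ⟨a, b, ha, hb, h⟩)⟩
    · simp at h
    · cases ha; cases hb; exact h
    · simp at h
    · cases ha; cases hb; exact h.symm
  · exact fun h => ⟨by simpa using h.ne, .inl (.inr ⟨i, j, rfl, rfl, h⟩)⟩

/-- The vertex `k mod n` of the `n`-cycle. -/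
def cycleVertex {n : ℕ} (hn : 4 ≤ n) (k : ℕ) : Fin n := ⟨k % n, Nat.mod_lt _ (by omega)⟩

theorem cycleVertex_val {n : ℕ} (hn : 4 ≤ n) (i : Fin n) : cycleVertex hn i.val = i :=
  Fin.ext (Nat.mod_eq_of_lt i.isLt)

theorem cycleGraph_adj_cycleVertex_succ {n : ℕ} (hn : 4 ≤ n) (k : ℕ) :
    (cycleGraph n).Adj (cycleVertex hn k) (cycleVertex hn (k + 1)) := by
  rw [cycleGraph_adj_iff_val (by omega)]
  simp [cycleVertex]

theorem val_cycleVertex_succ {n : ℕ} (hn : 4 ≤ n) (k : ℕ) :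
    (cycleVertex hn (k + 1)).val =
      if (cycleVertex hn k).val + 1 = n then 0 else (cycleVertex hn k).val + 1 := by
  have h := (cycleVertex hn k).isLt
  have e : (cycleVertex hn (k + 1)).val = ((cycleVertex hn k).val + 1) % n := by
    simp [cycleVertex]
  rw [e]
  split_ifs with h'
  · rw [h', Nat.mod_self]
  · exact Nat.mod_eq_of_lt (by omega)

theorem cycleVertex_ne_add_two {n : ℕ} (hn : 4 ≤ n) (k : ℕ) :
    cycleVertex hn k ≠ cycleVertex hn (k + 2) := by
  intro h
  have h₁ := val_cycleVertex_succ hn k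
  have h₂ := val_cycleVertex_succ hn (k + 1)
  have h₃ := congrArg Fin.val h
  simp only [add_assoc, Nat.reduceAdd] at h₁ h₂
  have := (cycleVertex hn k).isLt
  split_ifs at h₁ h₂ <;> omega

theorem not_cycleGraph_adj_cycleVertex_add_two {n : ℕ} (hn : 4 ≤ n) (k : ℕ) :
    ¬ (cycleGraph n).Adj (cycleVertex hn k) (cycleVertex hn (k + 2)) := by
  rw [cycleGraph_adj_iff_val (by omega)]
  have h₁ := val_cycleVertex_succ hn k
  have h₂ := val_cycleVertex_succ hn (k + 1)
  have h₃ := val_cycleVertex_succ hn (k + 2)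
  have e₁ : (cycleVertex hn (k + 1)).val = ((cycleVertex hn k).val + 1) % n := by
    simp [cycleVertex]
  have e₃ : (cycleVertex hn (k + 3)).val = ((cycleVertex hn (k + 2)).val + 1) % n := by
    simp [cycleVertex]
  rw [← e₁, ← e₃]
  simp only [add_assoc, Nat.reduceAdd] at h₁ h₂ h₃
  have := (cycleVertex hn k).isLt
  split_ifs at h₁ h₂ h₃ <;> omega

/-- Rainbow vertex-disconnection colorings of a wheel are those in which the color of the hub
is not reused and any two rim vertices at distance two along the rim have distinct colors. -/
theorem isRVDColoring_wheelGraph_iff {n : ℕ} (hn : 4 ≤ n) (c : Option (Fin n) → ℕ) :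
    IsRVDColoring (wheelGraph n) c ↔ (∀ i, c (some i) ≠ c none) ∧
      ∀ k, c (some (cycleVertex hn k)) ≠ c (some (cycleVertex hn (k + 2))) := by
  constructor
  · intro h
    constructor
    · intro i
      obtain ⟨k, rfl⟩ : ∃ k, i = cycleVertex hn (k + 1) := by
        refine ⟨i.val + n - 1, Fin.ext ?_⟩
        rw [show i.val + n - 1 + 1 = i.val + n by omega]
        simp [cycleVertex, Nat.mod_eq_of_lt i.isLt]
      obtain ⟨S, hx, hy, hS, hr, -⟩ := h (some (cycleVertex hn k)) (some (cycleVertex hn (k + 2)))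
        (by simpa using cycleVertex_ne_add_two hn k)
      have hr := hr (by
        rw [wheelGraph_adj_some_some]; exact not_cycleGraph_adj_cycleVertex_add_two hn k)
      have h₁ := mem_cut_of_adj_of_adj hx hy hS (wheelGraph_adj_none_some _).symm
        (wheelGraph_adj_none_some _)
      have h₂ := mem_cut_of_adj_of_adj hx hy hS
        ((wheelGraph_adj_some_some _ _).2 (cycleGraph_adj_cycleVertex_succ hn k))
        ((wheelGraph_adj_some_some _ _).2 (cycleGraph_adj_cycleVertex_succ hn (k + 1)))
      intro e
      exact Option.some_ne_none _ (hr h₂ h₁ e)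
    · intro k e
      obtain ⟨S, hx, hy, hS, -, hr⟩ := h none (some (cycleVertex hn (k + 1))) (by simp)
      have h₁ := mem_cut_of_adj_of_adj hx hy hS (wheelGraph_adj_none_some _)
        ((wheelGraph_adj_some_some _ _).2 (cycleGraph_adj_cycleVertex_succ hn k))
      have h₂ := mem_cut_of_adj_of_adj hx hy hS (wheelGraph_adj_none_some _)
        ((wheelGraph_adj_some_some _ _).2 (cycleGraph_adj_cycleVertex_succ hn (k + 1)).symm)
      have hinj : Set.InjOn c S := by
        rcases hr (wheelGraph_adj_none_some _) with h | h
        · exact Set.InjOn.mono (Set.subset_insert _ _) h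
        · exact Set.InjOn.mono (Set.subset_insert _ _) h
      exact cycleVertex_ne_add_two hn k (Option.some_injective _ (hinj h₁ h₂ e))
  · rintro ⟨h₀, h₂⟩
    have hinj : ∀ i, Set.InjOn c ((wheelGraph n).neighborSet (some i)) := by
      rintro i (_ | a) ha (_ | b) hb e
      · rfl
      · exact absurd e.symm (h₀ b)
      · exact absurd e (h₀ a)
      · rw [SimpleGraph.mem_neighborSet, wheelGraph_adj_some_some,
          cycleGraph_adj_iff_val (by omega)] at ha hb
        have hsucc : ∀ {u v : Fin n}, (u.val + 1) % n = v.val → v = cycleVertex hn (u.val + 1) :=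
          fun h => Fin.ext h.symm
        have hstep : ∀ {u v w : Fin n}, (u.val + 1) % n = v.val → (v.val + 1) % n = w.val →
            c (some u) ≠ c (some w) := by
          intro u v w huv hvw
          have hw : w = cycleVertex hn (u.val + 2) := by
            apply Fin.ext
            rw [← hvw, ← huv]
            simp [cycleVertex]
          rw [hw]
          simpa only [cycleVertex_val] using h₂ u.val
        rcases ha with ha | ha <;> rcases hb with hb | hb
        · rw [hsucc ha, hsucc hb]
        · exact absurd e.symm (hstep hb ha)
        · exact absurd e (hstep ha hb)
        · have := a.isLt
          have := b.isLt
          congr 1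
          apply Fin.ext
          have hm : a.val + 1 ≡ b.val + 1 [MOD n] := ha.trans hb.symm
          exact (Nat.ModEq.add_right_cancel' 1 hm).eq_of_lt_of_lt a.isLt b.isLt
    apply isRVDColoring_of_injOn_neighborSet
    rintro (_ | i) y hxy
    · rcases y with _ | j
      · exact absurd rfl hxy
      · exact .inr (hinj j)
    · exact .inl (hinj i)

/-- A rainbow vertex-disconnection coloring of a wheel uses at least three colors. -/
theorem three_le_ncard_range_of_isRVDColoring {n : ℕ} (hn : 4 ≤ n) {c : Option (Fin n) → ℕ}
    (hc : IsRVDColoring (wheelGraph n) c) : 3 ≤ (Set.range c).ncard := by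
  obtain ⟨h₀, h₂⟩ := (isRVDColoring_wheelGraph_iff hn c).1 hc
  have hsub : (↑({c none, c (some (cycleVertex hn 0)), c (some (cycleVertex hn 2))} : Finset ℕ) :
      Set ℕ) ⊆ Set.range c := by
    intro z hz
    simp only [Finset.coe_insert, Finset.coe_singleton, Set.mem_insert_iff,
      Set.mem_singleton_iff] at hz
    rcases hz with rfl | rfl | rfl <;> exact Set.mem_range_self _
  have hle := Set.ncard_le_ncard hsub (Set.finite_range c)
  rwa [Set.ncard_coe_finset, Finset.card_eq_three.2
    ⟨_, _, _, (h₀ _).symm, (h₀ _).symm, h₂ 0, rfl⟩] at hle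

/-- If a wheel has a rainbow vertex-disconnection coloring with at most three colors, then the
length of its rim is divisible by four. -/
theorem four_dvd_of_isRVDColoring {n : ℕ} (hn : 4 ≤ n) {c : Option (Fin n) → ℕ}
    (hc : IsRVDColoring (wheelGraph n) c) (hcard : (Set.range c).ncard ≤ 3) : 4 ∣ n := by
  obtain ⟨h₀, h₂⟩ := (isRVDColoring_wheelGraph_iff hn c).1 hc
  have hper : ∀ k, c (some (cycleVertex hn (k + 4))) = c (some (cycleVertex hn k)) := by
    intro k
    by_contra hne
    have hsub : (↑({c none, c (some (cycleVertex hn k)), c (some (cycleVertex hn (k + 2))),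
        c (some (cycleVertex hn (k + 4)))} : Finset ℕ) : Set ℕ) ⊆ Set.range c := by
      intro z hz
      simp only [Finset.coe_insert, Finset.coe_singleton, Set.mem_insert_iff,
        Set.mem_singleton_iff] at hz
      rcases hz with rfl | rfl | rfl | rfl <;> exact Set.mem_range_self _
    have hle := Set.ncard_le_ncard hsub (Set.finite_range c)
    rw [Set.ncard_coe_finset, Finset.card_insert_of_notMem, Finset.card_eq_three.2
      ⟨_, _, _, h₂ k, Ne.symm hne, h₂ (k + 2), rfl⟩] at hle
    · omega
    · simp [(h₀ _).symm]
  have hmul : ∀ q k, c (some (cycleVertex hn (k + 4 * q))) = c (some (cycleVertex hn k)) := by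
    intro q k
    induction q with
    | zero => rfl
    | succ q ih => exact (hper (k + 4 * q)).trans ih
  have hzero : ∀ m, cycleVertex hn (n * m) = cycleVertex hn 0 := by
    intro m
    apply Fin.ext
    simp [cycleVertex]
  have hno : ∀ m q, n * m ≠ 2 + 4 * q := by
    intro m q e
    apply h₂ 0
    rw [← hzero m, e, hmul, zero_add]
  by_contra hdvd
  have h₁ := hno 1 (n / 4)
  have h₂ := hno 2 (n / 2)
  omega

/-- A coloring of the rim by `f`, with values below `k` and with distinct values at distance two,
extends to a rainbow vertex-disconnection coloring of the wheel with at most `k + 1` colors. -/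
theorem exists_isRVDColoring_of_rim {n k : ℕ} (hn : 4 ≤ n) (f : ℕ → ℕ) (hf : ∀ i, f i < k)
    (h : ∀ i, i + 2 < n → f i ≠ f (i + 2)) (h₀ : f (n - 2) ≠ f 0) (h₁ : f (n - 1) ≠ f 1) :
    ∃ c : Option (Fin n) → ℕ, IsRVDColoring (wheelGraph n) c ∧ (Set.range c).ncard ≤ k + 1 := by
  refine ⟨fun x => x.elim k fun i => f i.val, ?_, ?_⟩
  · rw [isRVDColoring_wheelGraph_iff hn]
    refine ⟨fun i => (hf _).ne, fun j => ?_⟩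
    change f (cycleVertex hn j).val ≠ f (cycleVertex hn (j + 2)).val
    have hj := (cycleVertex hn j).isLt
    have e₁ := val_cycleVertex_succ hn j
    have e₂ := val_cycleVertex_succ hn (j + 1)
    rw [e₁, add_assoc, one_add_one_eq_two] at e₂
    generalize (cycleVertex hn j).val = a at *
    rw [e₂]
    split_ifs with ha hb hb
    · omega
    · rwa [show a = n - 1 by omega]
    · rwa [show a = n - 2 by omega]
    · exact h a (by omega)
  · have hsub : Set.range (fun x : Option (Fin n) => x.elim k fun i => f i.val) ⊆
        ↑(Finset.range (k + 1)) := by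
      rintro _ ⟨_ | i, rfl⟩
      · simp
      · simpa using (hf i.val).le
    simpa using Set.ncard_le_ncard hsub (Finset.finite_toSet _)

theorem exists_isRVDColoring_wheelGraph_three {n : ℕ} (hn : 4 ≤ n) (hdvd : 4 ∣ n) :
    ∃ c : Option (Fin n) → ℕ, IsRVDColoring (wheelGraph n) c ∧ (Set.range c).ncard ≤ 3 :=
  exists_isRVDColoring_of_rim hn (fun i => i / 2 % 2) (fun i => Nat.mod_lt _ (by omega))
    (fun i _ => by omega) (by omega) (by omega)

theorem exists_isRVDColoring_wheelGraph_four {n : ℕ} (hn : 4 ≤ n) :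
    ∃ c : Option (Fin n) → ℕ, IsRVDColoring (wheelGraph n) c ∧ (Set.range c).ncard ≤ 4 := by
  refine exists_isRVDColoring_of_rim hn (fun i => if i < n - 2 then i / 2 % 2 else 2)
    (fun i => ?_) (fun i _ => ?_) ?_ ?_ <;> split_ifs <;> omega

theorem rvd_eq_of_isLeast {V : Type*} {G : SimpleGraph V} {k : ℕ}
    (hex : ∃ c : V → ℕ, IsRVDColoring G c ∧ (Set.range c).ncard ≤ k)
    (hle : ∀ c : V → ℕ, IsRVDColoring G c → k ≤ (Set.range c).ncard) : rvd G = k := by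
  obtain ⟨c, hc, hk⟩ := hex
  refine IsLeast.csInf_eq ⟨⟨c, hc, hk.antisymm (hle c hc)⟩, ?_⟩
  rintro _ ⟨d, hd, rfl⟩
  exact hle d hd

/-- For the wheel `W n` of order `n + 1 ≥ 5`: `rvd (W n) = 3` if `4 ∣ n`, and
`rvd (W n) = 4` otherwise. -/
theorem stmt12 (n : ℕ) (hn : 4 ≤ n) :
    (4 ∣ n → rvd (wheelGraph n) = 3) ∧ (¬ 4 ∣ n → rvd (wheelGraph n) = 4) := by
  refine ⟨fun h => rvd_eq_of_isLeast (exists_isRVDColoring_wheelGraph_three hn h)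
      fun c hc => three_le_ncard_range_of_isRVDColoring hn hc,
    fun h => rvd_eq_of_isLeast (exists_isRVDColoring_wheelGraph_four hn) fun c hc => ?_⟩
  by_contra hlt
  exact h (four_dvd_of_isRVDColoring hn hc (by omega))
end
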